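/- Suppose A ∈ B^{m,i}, pr(A) ∈ B^{s,i} for some s ≥ m, and φ_{i−1}(A) ≠ 0. Then Σ_{r=1}^{i−1} pr(A)_{r,i} + Σ_{r=i}^{n} pr(A)_{i,r} = m − φ_{i−1}(A) < m; in particular the Kashiwara operator f_i defined with respect to the parameter m acts nontrivially on pr(A), and its action agrees with that of f_i defined with respect to s. -/

import Mathlib

open Finset

namespace KR

/-- Arrays of integers indexed by (column, row). -/
abbrev Arr := ℕ → ℕ → ℤ

/-- A Dyck path from (1,i) to (i,n). -/
def IsDyck (n i : ℕ) (L : List (ℕ × ℕ)) : Prop :=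
  L ≠ [] ∧ L.head? = some (1, i) ∧ L.getLast? = some (i, n) ∧
    L.Chain' (fun β γ => γ = (β.1, β.2 + 1) ∨ γ = (β.1 + 1, β.2))

/-- Membership in the polytope `B^{m,i}`: nonnegative entries supported on the box
`1 ≤ p ≤ i`, `i ≤ q ≤ n`, with all Dyck path sums bounded by `m`. -/
def InB (n i m : ℕ) (A : Arr) : Prop :=
  (∀ p q, 1 ≤ p → p ≤ i → i ≤ q → q ≤ n → 0 ≤ A p q) ∧
  (∀ p q, ¬(1 ≤ p ∧ p ≤ i ∧ i ≤ q ∧ q ≤ n) → A p q = 0) ∧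
  (∀ L, IsDyck n i L → (L.map fun β => A β.1 β.2).sum ≤ (m : ℤ))

/-- The sum `Σ_{j=1}^{p} a_{j,l−1} + Σ_{j=p}^{i} a_{j,l}` (used for `l > i`). -/
def Fp (i : ℕ) (A : Arr) (l p : ℕ) : ℤ :=
  ∑ j ∈ Icc 1 p, A j (l - 1) + ∑ j ∈ Icc p i, A j l

/-- `p_+^l(A)`: minimal maximizer of `Fp` on `{1,…,i}`. -/
noncomputable def pplus (i : ℕ) (A : Arr) (l : ℕ) : ℕ :=
  sInf {p | p ∈ Icc 1 i ∧ ∀ q ∈ Icc 1 i, Fp i A l q ≤ Fp i A l p}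

/-- `q_+^l(A)`: maximal maximizer of `Fp` on `{1,…,i}`. -/
noncomputable def qplus (i : ℕ) (A : Arr) (l : ℕ) : ℕ :=
  sSup {p | p ∈ Icc 1 i ∧ ∀ q ∈ Icc 1 i, Fp i A l q ≤ Fp i A l p}

/-- The sum `Σ_{j=i}^{p} a_{l,j} + Σ_{j=p}^{n} a_{l+1,j}` (used for `l < i`). -/
def Fm (n i : ℕ) (A : Arr) (l p : ℕ) : ℤ :=
  ∑ j ∈ Icc i p, A l j + ∑ j ∈ Icc p n, A (l + 1) j

/-- `p_−^l(A)`: maximal maximizer of `Fm` on `{i,…,n}`. -/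
noncomputable def pminus (n i : ℕ) (A : Arr) (l : ℕ) : ℕ :=
  sSup {p | p ∈ Icc i n ∧ ∀ q ∈ Icc i n, Fm n i A l q ≤ Fm n i A l p}

/-- `q_−^l(A)`: minimal maximizer of `Fm` on `{i,…,n}`. -/
noncomputable def qminus (n i : ℕ) (A : Arr) (l : ℕ) : ℕ :=
  sInf {p | p ∈ Icc i n ∧ ∀ q ∈ Icc i n, Fm n i A l q ≤ Fm n i A l p}

/-- `φ_l(A)` (depending on the parameter `m` only when `l = i`). -/
noncomputable def phi (n i m : ℕ) (l : ℕ) (A : Arr) : ℤ :=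
  if l = i then (m : ℤ) - ∑ j ∈ Icc 1 (i - 1), A j i - ∑ j ∈ Icc i n, A i j
  else if i < l then
    ∑ j ∈ Icc 1 (pplus i A l), A j (l - 1) - ∑ j ∈ Icc 1 (pplus i A l - 1), A j l
  else
    ∑ j ∈ Icc (pminus n i A l) n, A (l + 1) j - ∑ j ∈ Icc (pminus n i A l + 1) n, A l j

/-- `ε_l(A)` (the parameter `m` is carried along for uniformity; it is not used). -/
noncomputable def eps (n i m : ℕ) (l : ℕ) (A : Arr) : ℤ :=
  if l = i then A i i
  else if i < l then
    ∑ j ∈ Icc (qplus i A l) i, A j l - ∑ j ∈ Icc (qplus i A l + 1) i, A j (l - 1)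
  else
    ∑ j ∈ Icc i (qminus n i A l), A l j - ∑ j ∈ Icc i (qminus n i A l - 1), A (l + 1) j

/-- Update a single entry of an array. -/
def upd (A : Arr) (p q : ℕ) (v : ℤ) : Arr :=
  fun p' q' => if p' = p ∧ q' = q then v else A p' q'

/-- The Kashiwara operator `f_l` (with `none` playing the role of `0`). -/
noncomputable def fop (n i m : ℕ) (l : ℕ) (A : Arr) : Option Arr :=
  if phi n i m l A = 0 then none
  else some <|
    if l = i then upd A i i (A i i + 1)
    else if i < l then
      upd (upd A (pplus i A l) (l - 1) (A (pplus i A l) (l - 1) - 1))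
        (pplus i A l) l (A (pplus i A l) l + 1)
    else
      upd (upd A l (pminus n i A l) (A l (pminus n i A l) + 1))
        (l + 1) (pminus n i A l) (A (l + 1) (pminus n i A l) - 1)

/-- The Kashiwara operator `e_l` (with `none` playing the role of `0`). -/
noncomputable def eop (n i m : ℕ) (l : ℕ) (A : Arr) : Option Arr :=
  if eps n i m l A = 0 then none
  else some <|
    if l = i then upd A i i (A i i - 1)
    else if i < l then
      upd (upd A (qplus i A l) (l - 1) (A (qplus i A l) (l - 1) + 1))
        (qplus i A l) l (A (qplus i A l) l - 1)
    else
      upd (upd A l (qminus n i A l) (A l (qminus n i A l) - 1))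
        (l + 1) (qminus n i A l) (A (l + 1) (qminus n i A l) + 1)

/-- Coefficient of `ω_j` in the simple root `α_r` (column `r` of the Cartan matrix). -/
def cart (j r : ℕ) : ℤ :=
  if r = j then 2 else if r = j + 1 ∨ j = r + 1 then -1 else 0

/-- The weight `wt(A) = mω_i − Σ a_{p,q} α_{p,q}`, expressed in the basis of
fundamental weights: `wtv n i m A j` is the coefficient of `ω_j`. -/
def wtv (n i m : ℕ) (A : Arr) (j : ℕ) : ℤ :=
  (m : ℤ) * (if j = i then 1 else 0) -
    ∑ p ∈ Icc 1 i, ∑ q ∈ Icc i n, A p q * ∑ r ∈ Icc p q, cart j r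

/-- The coefficient `c_l(p,q)` of the pairing `⟨α_l^∨, α_{p,q}⟩`. -/
def clpq (l p q : ℕ) : ℤ :=
  if p = l ∧ q = l then 2
  else if (l = p ∧ p < q) ∨ (p < q ∧ q = l) then 1
  else if l + 1 = p ∨ l = q + 1 then -1
  else 0

/-- The pairing `⟨α_l^∨, wt(A)⟩ = m·δ_{l,i} − Σ_{p,q} a_{p,q}·c_l(p,q)`. -/
def pairing (n i m : ℕ) (l : ℕ) (A : Arr) : ℤ :=
  (m : ℤ) * (if l = i then 1 else 0) -
    ∑ p ∈ Icc 1 i, ∑ q ∈ Icc i n, A p q * clpq l p q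

/-! ### The promotion algorithm -/

/-- Columns, indexed by rows `i,…,n`. -/
abbrev Col := ℕ → ℤ

/-- `Σ_{j=lo}^{p} a_j + Σ_{j=p}^{n} b_j`. -/
def Gc (n lo : ℕ) (a b : Col) (p : ℕ) : ℤ := ∑ j ∈ Icc lo p, a j + ∑ j ∈ Icc p n, b j

/-- `q_−` for two (truncated) columns with rows `lo,…,n`: the minimal maximizer of `Gc`. -/
noncomputable def qmc (n lo : ℕ) (a b : Col) : ℕ :=
  if lo ≤ n then
    max lo (sInf {p | p ∈ Icc lo n ∧ ∀ q ∈ Icc lo n, Gc n lo a b q ≤ Gc n lo a b p})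
  else n

/-- `ε` for two (truncated) columns with rows `lo,…,n`. -/
noncomputable def epsc (n lo : ℕ) (a b : Col) : ℤ :=
  ∑ j ∈ Icc lo (qmc n lo a b), a j - ∑ j ∈ Icc lo (qmc n lo a b - 1), b j

/-- The sequence `l_1 < l_2 < ⋯` of the promotion algorithm:
`l_1 = q_−(a,c)` and `l_{s+1} = q_−((a)^{≥ l_s + 1}, (c)^{≥ l_s + 1})`,
stabilizing at `n`. -/
noncomputable def lfun (n i : ℕ) (a c : Col) : ℕ → ℕ
  | 0 => qmc n i a c
  | s + 1 => qmc n (lfun n i a c s + 1) a c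

/-- The set `{l_1, …, l_t}` (with `l_t = n`). -/
noncomputable def lset (n i : ℕ) (a c : Col) : Finset ℕ := (Finset.range (n + 1)).image (lfun n i a c)

/-- The new column `ĉ` of formula (6.2). -/
noncomputable def hatc (n i : ℕ) (a c : Col) : Col := fun r =>
  if r = n then a n + c n
  else if r ∈ lset n i a c then a r + c r - epsc n (r + 1) a c
  else a r

/-- The output column of one step of the promotion algorithm. -/
noncomputable def prcol (n i : ℕ) (a c : Col) : Col := fun r =>
  if r = i then epsc n i a c
  else if r - 1 ∈ lset n i a c then epsc n r a c
  else c (r - 1)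

/-- The running columns of the promotion algorithm: `cseq 0` is the `i`-th column of `A`,
and `cseq (k+1)` is obtained from the `(i−1−k)`-th column of `A` and `cseq k`. -/
noncomputable def cseq (n i : ℕ) (A : Arr) : ℕ → Col
  | 0 => fun r => A i r
  | k + 1 => hatc n i (fun r => A (i - 1 - k) r) (cseq n i A k)

/-- The `j`-th column of `pr(A)` for `2 ≤ j ≤ i`. -/
noncomputable def prColJ (n i : ℕ) (A : Arr) (j : ℕ) : Col :=
  prcol n i (fun q => A (j - 1) q) (cseq n i A (i - j))

/-- The promotion map `pr` on `B^{m,i}`. -/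
noncomputable def prMap (n i m : ℕ) (A : Arr) : Arr := fun p r =>
  if 1 ≤ p ∧ p ≤ i ∧ i ≤ r ∧ r ≤ n then
    if p = 1 then
      if r = i then
        (m : ℤ) - (∑ j ∈ Icc i n, A i j) - ∑ j ∈ Icc 2 i, prColJ n i A j i
      else
        (∑ j ∈ Icc 1 i, A j (r - 1)) - ∑ j ∈ Icc 2 i, prColJ n i A j r
    else prColJ n i A p r
  else 0

/-- The content `(r_1,…,r_{n+1})` of an array. -/
def cont (n i m : ℕ) (A : Arr) (k : ℕ) : ℤ :=
  if k ≤ i then (m : ℤ) - ∑ q ∈ Icc i n, A k q else ∑ p ∈ Icc 1 i, A p (k - 1)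

/-- Splitting the sum over an interval at an interior point. -/
lemma sum_Icc_split (f : ℕ → ℤ) {lo p n : ℕ} (h1 : lo ≤ p) (h2 : p ≤ n) :
    ∑ j ∈ Icc lo n, f j = ∑ j ∈ Icc lo p, f j + ∑ j ∈ Icc (p + 1) n, f j := by
  have h := Finset.sum_Ico_consecutive f (show lo ≤ p + 1 by omega) (show p + 1 ≤ n + 1 by omega)
  have e (a b : ℕ) : Ico a (b + 1) = Icc a b := by ext; simp
  rw [e, e, e] at h
  exact h.symm

lemma exists_isMaximizer (F : ℕ → ℤ) {lo n : ℕ} (h : lo ≤ n) :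
    {p | p ∈ Icc lo n ∧ ∀ q ∈ Icc lo n, F q ≤ F p}.Nonempty := by
  obtain ⟨p, hp, hmax⟩ := (Icc lo n).exists_max_image F ⟨lo, by simp [h]⟩
  exact ⟨p, hp, hmax⟩

lemma qmc_spec {n lo : ℕ} (a c : Col) (h : lo ≤ n) :
    qmc n lo a c ∈ Icc lo n ∧
      ∀ q ∈ Icc lo n, Gc n lo a c q ≤ Gc n lo a c (qmc n lo a c) := by
  have hs := Nat.sInf_mem (exists_isMaximizer (Gc n lo a c) h)
  have hq : qmc n lo a c =
      sInf {p | p ∈ Icc lo n ∧ ∀ q ∈ Icc lo n, Gc n lo a c q ≤ Gc n lo a c p} := by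
    rw [qmc, if_pos h]
    exact max_eq_right (mem_Icc.1 hs.1).1
  rw [hq]
  exact hs

lemma qmc_le (n lo : ℕ) (a c : Col) : qmc n lo a c ≤ n := by
  by_cases h : lo ≤ n
  · exact (mem_Icc.1 (qmc_spec a c h).1).2
  · simp [qmc, h]

lemma min_le_qmc (n lo : ℕ) (a c : Col) : min n lo ≤ qmc n lo a c := by
  by_cases h : lo ≤ n
  · exact (min_le_right _ _).trans (mem_Icc.1 (qmc_spec a c h).1).1
  · simp [qmc, h]

lemma pminus_spec {n i : ℕ} (A : Arr) (l : ℕ) (h : i ≤ n) :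
    pminus n i A l ∈ Icc i n ∧ ∀ q ∈ Icc i n, Fm n i A l q ≤ Fm n i A l (pminus n i A l) :=
  Nat.sSup_mem (exists_isMaximizer (Fm n i A l) h)
    ⟨n, fun _ hp => (mem_Icc.1 hp.1).2⟩

/-- `ε` is the maximum of `Gc` minus the sum of the second column. -/
lemma epsc_eq {n lo : ℕ} (a c : Col) (h0 : 1 ≤ lo) (h : lo ≤ n) :
    epsc n lo a c = Gc n lo a c (qmc n lo a c) - ∑ j ∈ Icc lo n, c j := by
  have hq := mem_Icc.1 (qmc_spec a c h).1
  have hc : ∑ j ∈ Icc lo n, c j =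
      ∑ j ∈ Icc lo (qmc n lo a c - 1), c j + ∑ j ∈ Icc (qmc n lo a c) n, c j := by
    rcases hq.1.eq_or_lt with he | hl
    · rw [← he, Icc_eq_empty (a := lo) (b := lo - 1) (by omega)]
      simp
    · rw [sum_Icc_split c (show lo ≤ qmc n lo a c - 1 by omega) (by omega)]
      congr 3
      omega
  rw [epsc, Gc, hc]
  ring

lemma lfun_le (n lo : ℕ) (a c : Col) (t : ℕ) : lfun n lo a c t ≤ n := by
  cases t <;> exact qmc_le _ _ _ _

lemma min_le_lfun (n lo : ℕ) (a c : Col) (t : ℕ) : min n (lo + t) ≤ lfun n lo a c t := by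
  induction t with
  | zero => exact min_le_qmc n lo a c
  | succ t ih =>
    have := min_le_qmc n (lfun n lo a c t + 1) a c
    rw [lfun]
    omega

lemma lfun_succ' (n lo : ℕ) (a c : Col) (t : ℕ) :
    lfun n lo a c (t + 1) = lfun n (qmc n lo a c + 1) a c t := by
  induction t with
  | zero => rfl
  | succ t ih => rw [lfun, ih, lfun]

lemma mem_lset {n i : ℕ} (a c : Col) (r : ℕ) :
    r ∈ lset n i a c ↔ ∃ t, lfun n i a c t = r := by
  simp only [lset, mem_image, mem_range]
  refine ⟨fun ⟨t, _, h⟩ => ⟨t, h⟩, fun ⟨t, h⟩ => ?_⟩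
  by_cases ht : t < n + 1
  · exact ⟨t, ht, h⟩
  · have h1 := min_le_lfun n i a c t
    have h2 := lfun_le n i a c t
    have h3 := min_le_lfun n i a c n
    have h4 := lfun_le n i a c n
    exact ⟨n, by omega, by omega⟩

lemma qmc_mem_lset (n lo : ℕ) (a c : Col) : qmc n lo a c ∈ lset n lo a c :=
  (mem_lset a c _).2 ⟨0, rfl⟩

lemma qmc_le_of_mem_lset {n lo r : ℕ} (a c : Col) (hr : r ∈ lset n lo a c) :
    qmc n lo a c ≤ r := by
  obtain ⟨t, rfl⟩ := (mem_lset a c r).1 hr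
  have := qmc_le n lo a c
  cases t with
  | zero => exact le_rfl
  | succ t =>
    rw [lfun_succ']
    have := min_le_lfun n (qmc n lo a c + 1) a c t
    omega

lemma mem_lset_tail {n lo r : ℕ} (a c : Col) (hr : qmc n lo a c < r) :
    r ∈ lset n lo a c ↔ r ∈ lset n (qmc n lo a c + 1) a c := by
  rw [mem_lset, mem_lset]
  constructor
  · rintro ⟨t, ht⟩
    cases t with
    | zero => exact absurd ht hr.ne
    | succ t => exact ⟨t, by rw [← lfun_succ', ht]⟩
  · rintro ⟨t, ht⟩
    exact ⟨t + 1, by rw [lfun_succ', ht]⟩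

/-- The maximum of `Gc` minus the sum of the first column (that is, `φ`), computed along the
sequence `l_1 < l_2 < ⋯`. -/
lemma max_Gc_sub_sum (n : ℕ) (a c : Col) (lo : ℕ) (h : lo ≤ n) :
    Gc n lo a c (qmc n lo a c) - ∑ j ∈ Icc lo n, a j =
      c n + ∑ r ∈ Ico lo n, if r ∈ lset n lo a c then c r - epsc n (r + 1) a c else 0 := by
  induction hk : n - lo using Nat.strong_induction_on generalizing lo with
  | _ k ih =>
  obtain ⟨hlo, hle⟩ := mem_Icc.1 (qmc_spec a c h).1
  set l := qmc n lo a c with hl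
  have hzero : ∀ r ∈ Ico lo l,
      (if r ∈ lset n lo a c then c r - epsc n (r + 1) a c else 0) = 0 := by
    intro r hr
    rw [if_neg fun hm => ?_]
    have := qmc_le_of_mem_lset a c hm
    have := (mem_Ico.1 hr).2
    omega
  rcases hle.eq_or_lt with he | hlt
  · have hz := sum_eq_zero hzero
    rw [he] at hz ⊢
    rw [hz]
    simp [Gc]
  · rw [← sum_Ico_consecutive _ hlo hle, sum_eq_zero hzero, sum_eq_sum_Ico_succ_bot hlt,
      if_pos (qmc_mem_lset n lo a c), epsc_eq a c (by omega) hlt]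
    have htail : ∑ r ∈ Ico (l + 1) n,
        (if r ∈ lset n lo a c then c r - epsc n (r + 1) a c else 0) =
        ∑ r ∈ Ico (l + 1) n,
          (if r ∈ lset n (l + 1) a c then c r - epsc n (r + 1) a c else 0) := by
      refine sum_congr rfl fun r hr => ?_
      simp only [mem_lset_tail a c (show qmc n lo a c < r by have := (mem_Ico.1 hr).1; omega), hl]
    have hrec := ih _ (by omega) (l + 1) hlt rfl
    have hsa := sum_Icc_split a hlo hle
    have hsc := sum_Icc_split c (le_refl l) hle
    rw [Icc_self, sum_singleton] at hsc
    rw [htail, hsa, Gc, hsc]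
    linarith

lemma sum_prcol {n i : ℕ} (a c : Col) (hin : i ≤ n) :
    ∑ r ∈ Icc i n, prcol n i a c r = epsc n i a c + ∑ j ∈ Icc i n, c j -
      (Gc n i a c (qmc n i a c) - ∑ j ∈ Icc i n, a j) := by
  have e (f : ℕ → ℤ) : ∑ j ∈ Icc i n, f j = ∑ j ∈ Ico i (n + 1), f j := rfl
  have hs : ∑ r ∈ Ico (i + 1) (n + 1), prcol n i a c r = ∑ r ∈ Ico i n,
      (c r - if r ∈ lset n i a c then c r - epsc n (r + 1) a c else 0) := by
    rw [← sum_Ico_add' (prcol n i a c) i n 1]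
    refine sum_congr rfl fun r hr => ?_
    have := (mem_Ico.1 hr).1
    rw [prcol, if_neg (by omega), Nat.add_sub_cancel]
    split_ifs <;> ring
  rw [max_Gc_sub_sum n a c i hin, e, e c, sum_eq_sum_Ico_succ_bot (by omega), hs,
    sum_sub_distrib, sum_Ico_succ_top hin, prcol, if_pos rfl]
  ring

/-- `φ_l` for `l < i` is the maximum of `Gc` minus the sum of the `l`-th column. -/
lemma phi_eq {n i l : ℕ} (m : ℕ) (A : Arr) (hl : l < i) (hin : i ≤ n) :
    phi n i m l A = Gc n i (A l) (A (l + 1)) (qmc n i (A l) (A (l + 1))) -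
      ∑ j ∈ Icc i n, A l j := by
  obtain ⟨hp, hpmax⟩ := pminus_spec A l hin
  obtain ⟨hq, hqmax⟩ := qmc_spec (A l) (A (l + 1)) hin
  have heq : Fm n i A l (pminus n i A l) = Gc n i (A l) (A (l + 1)) _ :=
    le_antisymm (hqmax _ hp) (hpmax _ hq)
  rw [phi, if_neg hl.ne, if_neg hl.not_gt, ← heq, Fm,
    sum_Icc_split (A l) (mem_Icc.1 hp).1 (mem_Icc.1 hp).2]
  ring

lemma phi_nonneg {n i l : ℕ} (m : ℕ) (A : Arr) (hl : l < i) (hin : i ≤ n)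
    (hA : 0 ≤ A (l + 1) n) : 0 ≤ phi n i m l A := by
  have h := (qmc_spec (A l) (A (l + 1)) hin).2 n (by simp [hin])
  rw [phi_eq m A hl hin]
  simp only [Gc, Icc_self, sum_singleton] at h ⊢
  linarith

lemma prMap_eq_prColJ {n i m p r : ℕ} (A : Arr) (hp : 2 ≤ p) (hpi : p ≤ i) (hir : i ≤ r)
    (hrn : r ≤ n) : prMap n i m A p r = prColJ n i A p r := by
  rw [prMap, if_pos ⟨by omega, hpi, hir, hrn⟩, if_neg (by omega)]

lemma sum_row_prMap {n i : ℕ} (m : ℕ) (A : Arr) (hi : 2 ≤ i) (hin : i ≤ n) :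
    ∑ r ∈ Icc 1 (i - 1), prMap n i m A r i =
      (m : ℤ) - ∑ j ∈ Icc i n, A i j - prColJ n i A i i := by
  have h1 := sum_Icc_split (fun r => prMap n i m A r i) (le_refl 1) (show 1 ≤ i - 1 by omega)
  have h2 : ∑ r ∈ Icc (1 + 1) (i - 1), prMap n i m A r i =
      ∑ r ∈ Icc 2 (i - 1), prColJ n i A r i := by
    refine sum_congr rfl fun r hr => ?_
    have := mem_Icc.1 hr
    exact prMap_eq_prColJ A this.1 (by omega) le_rfl hin
  have h3 : ∑ j ∈ Icc 2 i, prColJ n i A j i =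
      ∑ j ∈ Icc 2 (i - 1), prColJ n i A j i + prColJ n i A i i := by
    obtain ⟨k, rfl⟩ : ∃ k, i = k + 1 := ⟨i - 1, by omega⟩
    exact sum_Icc_succ_top hi _
  rw [Icc_self, sum_singleton] at h1
  rw [h1, h2, prMap, if_pos ⟨le_rfl, by omega, le_rfl, hin⟩, if_pos rfl, if_pos rfl, h3]
  ring

/-- If `A ∈ B^{m,i}`, `pr(A) ∈ B^{s,i}` with `s ≥ m` and
`φ_{i−1}(A) ≠ 0`, then `Σ_{r=1}^{i−1} pr(A)_{r,i} + Σ_{r=i}^{n} pr(A)_{i,r}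
= m − φ_{i−1}(A) < m`; in particular `f_i` taken with respect to `m` acts
nontrivially on `pr(A)` and agrees with `f_i` taken with respect to `s`. -/
theorem stmt14 (n i m s : ℕ) (hi : 2 ≤ i) (hin : i ≤ n) (hms : m ≤ s) (A : Arr)
    (hA : InB n i m A) (hpr : InB n i s (prMap n i m A))
    (hphi : phi n i m (i - 1) A ≠ 0) :
    ((∑ r ∈ Finset.Icc 1 (i - 1), prMap n i m A r i) +
        ∑ r ∈ Finset.Icc i n, prMap n i m A i r = (m : ℤ) - phi n i m (i - 1) A) ∧
    ((∑ r ∈ Finset.Icc 1 (i - 1), prMap n i m A r i) +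
        ∑ r ∈ Finset.Icc i n, prMap n i m A i r < (m : ℤ)) ∧
    fop n i m i (prMap n i m A) ≠ none ∧
    fop n i m i (prMap n i m A) = fop n i s i (prMap n i m A) := by
  have hi1 : i - 1 + 1 = i := by omega
  have hnn : 0 ≤ phi n i m (i - 1) A :=
    phi_nonneg m A (by omega) hin (by rw [hi1]; exact hA.1 i n (by omega) le_rfl hin le_rfl)
  have hcol : ∑ r ∈ Icc i n, prMap n i m A i r = ∑ r ∈ Icc i n, prcol n i (A (i - 1)) (A i) r := by
    refine sum_congr rfl fun r hr => ?_
    rw [prMap_eq_prColJ A hi le_rfl (mem_Icc.1 hr).1 (mem_Icc.1 hr).2, prColJ, Nat.sub_self]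
    rfl
  have hii : prColJ n i A i i = epsc n i (A (i - 1)) (A i) := by
    rw [prColJ, Nat.sub_self, prcol, if_pos rfl]
    rfl
  have key : (∑ r ∈ Icc 1 (i - 1), prMap n i m A r i) + ∑ r ∈ Icc i n, prMap n i m A i r =
      (m : ℤ) - phi n i m (i - 1) A := by
    rw [sum_row_prMap m A hi hin, hcol, sum_prcol _ _ hin, hii,
      phi_eq m A (show i - 1 < i by omega) hin, hi1]
    ring
  have hlt : (∑ r ∈ Icc 1 (i - 1), prMap n i m A r i) + ∑ r ∈ Icc i n, prMap n i m A i r <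
      (m : ℤ) := by
    have := lt_of_le_of_ne hnn hphi.symm
    linarith
  have hm : phi n i m i (prMap n i m A) ≠ 0 := by
    rw [phi, if_pos rfl]
    linarith
  have hs : phi n i s i (prMap n i m A) ≠ 0 := by
    have : (m : ℤ) ≤ s := by exact_mod_cast hms
    rw [phi, if_pos rfl]
    linarith
  refine ⟨key, hlt, ?_, ?_⟩
  · simp [fop, hm]
  · simp [fop, hm, hs]

end KR
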